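/- arXiv:1211.0865 — 2 statements merged into one kernel-verified Lean document; each statement's English description precedes it below -/
import Mathlib

section
/- (Type Safety) If a standard term t is closed, t →a* T for some type T, and t →c* m where m is a normal form with respect to call-by-value reduction →c, then m is a standard value. -/
/-- Simple types: `T ::= A | T₁ ⇒ T₂`. -/
inductive MTy : Type
  | base : MTy
  | arrow : MTy → MTy → MTy
  deriving DecidableEq

/-- Mixed terms (de Bruijn indices for variables):
`m ::= x | λx:T.m | m m' | a | f | A | T ⇒ m`. -/
inductive MTm : Type
  | var : ℕ → MTm
  | lam : MTy → MTm → MTm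
  | app : MTm → MTm → MTm
  | ca : MTm            -- the term constant `a`
  | cf : MTm            -- the term constant `f`
  | tyA : MTm           -- the base type `A` as a mixed term
  | arr : MTy → MTm → MTm  -- `T ⇒ m`
  deriving DecidableEq

namespace MTm

/-- The embedding of types into mixed terms. -/
def ofTy : MTy → MTm
  | .base => tyA
  | .arrow T1 T2 => arr T1 (ofTy T2)

/-- de Bruijn shifting of indices `≥ c` by `d`. -/
def shift (d c : ℕ) : MTm → MTm
  | var k => if k < c then var k else var (k + d)
  | lam T m => lam T (shift d (c + 1) m)
  | app m1 m2 => app (shift d c m1) (shift d c m2)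
  | ca => ca
  | cf => cf
  | tyA => tyA
  | arr T m => arr T (shift d c m)

/-- Capture-avoiding substitution `[s / j] m` (de Bruijn). -/
def subst (j : ℕ) (s : MTm) : MTm → MTm
  | var k => if k = j then s else if j < k then var (k - 1) else var k
  | lam T m => lam T (subst (j + 1) (shift 1 0 s) m)
  | app m1 m2 => app (subst j s m1) (subst j s m2)
  | ca => ca
  | cf => cf
  | tyA => tyA
  | arr T m => arr T (subst j s m)

/-- Mixed values: `u ::= λx:T.m | T ⇒ m | A | a | f`. -/
inductive IsValue : MTm → Prop
  | lam (T m) : IsValue (lam T m)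
  | arr (T m) : IsValue (arr T m)
  | tyA : IsValue tyA
  | ca : IsValue ca
  | cf : IsValue cf

/-- Abstract reduction `→a`, closed under arbitrary contexts. -/
inductive StepA : MTm → MTm → Prop
  | beta (T m) : StepA (app (arr T m) (ofTy T)) m
  | lamAbs (T m) : StepA (lam T m) (arr T (subst 0 (ofTy T) m))
  | cfAbs : StepA cf (arr .base tyA)
  | caAbs : StepA ca tyA
  | lamC {m m'} (T) : StepA m m' → StepA (lam T m) (lam T m')
  | appL {m1 m1'} (m2) : StepA m1 m1' → StepA (app m1 m2) (app m1' m2)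
  | appR {m2 m2'} (m1) : StepA m2 m2' → StepA (app m1 m2) (app m1 m2')
  | arrC {m m'} (T) : StepA m m' → StepA (arr T m) (arr T m')

/-- Concrete full β-reduction `→b`, closed under arbitrary contexts. -/
inductive StepB : MTm → MTm → Prop
  | beta (T m m') : StepB (app (lam T m) m') (subst 0 m' m)
  | fa : StepB (app cf ca) ca
  | lamC {m m'} (T) : StepB m m' → StepB (lam T m) (lam T m')
  | appL {m1 m1'} (m2) : StepB m1 m1' → StepB (app m1 m2) (app m1' m2)
  | appR {m2 m2'} (m1) : StepB m2 m2' → StepB (app m1 m2) (app m1 m2')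
  | arrC {m m'} (T) : StepB m m' → StepB (arr T m) (arr T m')

/-- Call-by-value reduction `→c`: redexes contracted inside
call-by-value evaluation contexts `E_c ::= * | E_c m | u E_c`. -/
inductive StepC : MTm → MTm → Prop
  | beta {u} (T m) : IsValue u → StepC (app (lam T m) u) (subst 0 u m)
  | fa : StepC (app cf ca) ca
  | appL {m1 m1'} (m2) : StepC m1 m1' → StepC (app m1 m2) (app m1' m2)
  | appR {u m2 m2'} : IsValue u → StepC m2 m2' → StepC (app u m2) (app u m2')

/-- Standard terms: mixed terms containing no type subterm. -/
inductive IsStandard : MTm → Prop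
  | var (x) : IsStandard (var x)
  | lam (T) {t} : IsStandard t → IsStandard (lam T t)
  | app {t1 t2} : IsStandard t1 → IsStandard t2 → IsStandard (app t1 t2)
  | ca : IsStandard ca
  | cf : IsStandard cf

/-- Standard values: `v ::= λx:T.t | a | f` with `t` standard. -/
inductive IsStdValue : MTm → Prop
  | lam (T) {t} : IsStandard t → IsStdValue (lam T t)
  | ca : IsStdValue ca
  | cf : IsStdValue cf

/-- All free de Bruijn indices are `< n`. -/
def ClosedUnder : ℕ → MTm → Prop
  | n, var k => k < n
  | n, lam _ m => ClosedUnder (n + 1) m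
  | n, app m1 m2 => ClosedUnder n m1 ∧ ClosedUnder n m2
  | _, ca => True
  | _, cf => True
  | _, tyA => True
  | n, arr _ m => ClosedUnder n m

/-- Quasi-stuck terms. -/
inductive QuasiStuck : MTm → Prop
  | val {u} : IsValue u → QuasiStuck u
  | app_ca {s} : QuasiStuck s → QuasiStuck (app ca s)
  | app_tyA {s} : QuasiStuck s → QuasiStuck (app tyA s)
  | app_cf {s} : QuasiStuck s → s ≠ ca → s ≠ tyA → QuasiStuck (app cf s)
  | app_AA {s} : QuasiStuck s → s ≠ ca → s ≠ tyA →
      QuasiStuck (app (arr .base tyA) s)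
  | app_lam {s} (T m) : QuasiStuck s → ¬ IsValue s → QuasiStuck (app (lam T m) s)
  | app_arr {s} (T m) : QuasiStuck s → ¬ IsValue s → QuasiStuck (app (arr T m) s)
  | app_app {s s'} : QuasiStuck s → QuasiStuck s' → ¬ IsValue s →
      QuasiStuck (app s s')

end MTm

namespace MTm

/-- The result type of applying a function of one type to an argument of another. -/
def applyTy : Option MTy → Option MTy → Option MTy
  | some (.arrow S T), some S' => if S = S' then some T else none
  | _, _ => none

/-- The simple type of a mixed term in a context, with types typed by themselves. -/
def infer : List MTy → MTm → Option MTy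
  | Γ, var k => Γ[k]?
  | Γ, lam T m => (infer (T :: Γ) m).map (MTy.arrow T)
  | Γ, app m1 m2 => applyTy (infer Γ m1) (infer Γ m2)
  | _, ca => some .base
  | _, cf => some (.arrow .base .base)
  | _, tyA => some .base
  | Γ, arr T m => (infer Γ m).map (MTy.arrow T)

theorem applyTy_eq_some {o o' : Option MTy} {T : MTy} :
    applyTy o o' = some T ↔ ∃ S, o = some (.arrow S T) ∧ o' = some S := by
  unfold applyTy
  split
  · split_ifs <;> grind
  · grind

theorem infer_ofTy (Γ : List MTy) (T : MTy) : infer Γ (ofTy T) = some T := by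
  induction T with
  | base => rfl
  | arrow S T _ ih => simp [ofTy, infer, ih]

theorem infer_shift (m : MTm) (Γ₁ Γ₂ : List MTy) (S : MTy) :
    infer (Γ₁ ++ S :: Γ₂) (shift 1 Γ₁.length m) = infer (Γ₁ ++ Γ₂) m := by
  induction m generalizing Γ₁ with
  | var k =>
    simp only [shift]
    split_ifs with h <;> simp only [infer] <;> grind
  | lam T m ih => simpa [shift, infer] using congrArg _ (ih (T :: Γ₁))
  | app m₁ m₂ ih₁ ih₂ => simp [shift, infer, ih₁, ih₂]
  | ca | cf | tyA => rfl
  | arr T m ih => simp [shift, infer, ih]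

theorem infer_subst (m s : MTm) (Γ₁ Γ₂ : List MTy) (S : MTy)
    (hs : infer (Γ₁ ++ Γ₂) s = some S) :
    infer (Γ₁ ++ Γ₂) (subst Γ₁.length s m) = infer (Γ₁ ++ S :: Γ₂) m := by
  induction m generalizing Γ₁ s with
  | var k =>
    simp only [subst]
    split_ifs with h h' <;> simp only [infer] <;> grind
  | lam T m ih =>
    have h := ih (shift 1 0 s) (T :: Γ₁) ((infer_shift s [] (Γ₁ ++ Γ₂) T).trans hs)
    simpa [subst, infer] using congrArg _ h
  | app m₁ m₂ ih₁ ih₂ => simp [subst, infer, ih₁ _ _ hs, ih₂ _ _ hs]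
  | ca | cf | tyA => rfl
  | arr T m ih => simp [subst, infer, ih _ _ hs]

/-- Types are preserved backwards along abstract reduction. -/
theorem StepA.infer_expansion {m m' : MTm} (h : StepA m m') {Γ : List MTy} {T : MTy}
    (hT : infer Γ m' = some T) : infer Γ m = some T := by
  induction h generalizing Γ T with
  | beta S m => simp [infer, infer_ofTy, hT, applyTy]
  | lamAbs S m =>
    rw [← hT]
    simpa [infer] using congrArg (Option.map (MTy.arrow S))
      (infer_subst m (ofTy S) [] Γ S (infer_ofTy Γ S)).symm
  | cfAbs | caAbs => exact hT
  | lamC S _ ih | arrC S _ ih =>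
    obtain ⟨U, hU, rfl⟩ := Option.map_eq_some_iff.mp hT
    simp [infer, ih hU]
  | appL m₂ _ ih =>
    obtain ⟨S, h₁, h₂⟩ := applyTy_eq_some.mp hT
    exact applyTy_eq_some.mpr ⟨S, ih h₁, h₂⟩
  | appR m₁ _ ih =>
    obtain ⟨S, h₁, h₂⟩ := applyTy_eq_some.mp hT
    exact applyTy_eq_some.mpr ⟨S, h₁, ih h₂⟩

/-- Types are preserved along call-by-value reduction. -/
theorem StepC.infer_preservation {m m' : MTm} (h : StepC m m') {Γ : List MTy} {T : MTy}
    (hT : infer Γ m = some T) : infer Γ m' = some T := by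
  induction h generalizing T with
  | @beta u S m _ =>
    obtain ⟨S', h₁, h₂⟩ := applyTy_eq_some.mp hT
    obtain ⟨U, hU, hSU⟩ := Option.map_eq_some_iff.mp h₁
    obtain ⟨rfl, rfl⟩ := MTy.arrow.inj hSU
    exact (infer_subst m u [] Γ _ h₂).trans hU
  | fa => simpa [infer, applyTy] using hT
  | appL m₂ _ ih =>
    obtain ⟨S, h₁, h₂⟩ := applyTy_eq_some.mp hT
    exact applyTy_eq_some.mpr ⟨S, ih h₁, h₂⟩
  | appR _ _ ih =>
    obtain ⟨S, h₁, h₂⟩ := applyTy_eq_some.mp hT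
    exact applyTy_eq_some.mpr ⟨S, h₁, ih h₂⟩

theorem IsStandard.shift {m : MTm} (h : IsStandard m) (d c : ℕ) :
    IsStandard (MTm.shift d c m) := by
  induction h generalizing c with
  | var k =>
    simp only [MTm.shift]
    split_ifs <;> exact .var _
  | lam T _ ih => exact .lam T (ih _)
  | app _ _ ih₁ ih₂ => exact .app (ih₁ _) (ih₂ _)
  | ca => exact .ca
  | cf => exact .cf

theorem IsStandard.subst {m s : MTm} (h : IsStandard m) (hs : IsStandard s) (j : ℕ) :
    IsStandard (MTm.subst j s m) := by
  induction h generalizing s j with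
  | var k =>
    simp only [MTm.subst]
    split_ifs
    exacts [hs, .var _, .var _]
  | lam T _ ih => exact .lam T (ih (hs.shift _ _) _)
  | app _ _ ih₁ ih₂ => exact .app (ih₁ hs _) (ih₂ hs _)
  | ca => exact .ca
  | cf => exact .cf

theorem StepC.isStandard {m m' : MTm} (h : StepC m m') (hm : IsStandard m) :
    IsStandard m' := by
  induction h with
  | beta T m _ =>
    obtain _ | _ | ⟨h₁, h₂⟩ := hm
    cases h₁ with
    | lam _ h => exact h.subst h₂ 0
  | fa => exact .ca
  | appL m₂ _ ih =>
    cases hm with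
    | app h₁ h₂ => exact .app (ih h₁) h₂
  | appR _ _ ih =>
    cases hm with
    | app h₁ h₂ => exact .app h₁ (ih h₂)

theorem IsStdValue.isValue {m : MTm} (h : IsStdValue m) : IsValue m := by
  cases h <;> constructor

/-- Closed typable standard terms are standard values or reduce. -/
theorem IsStandard.progress {m : MTm} (h : IsStandard m) {T : MTy}
    (hT : infer [] m = some T) : IsStdValue m ∨ ∃ m', StepC m m' := by
  induction h generalizing T with
  | var k => simp [infer] at hT
  | lam S h => exact .inl (.lam S h)
  | ca => exact .inl .ca
  | cf => exact .inl .cf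
  | app _ _ ih₁ ih₂ =>
    right
    obtain ⟨S, h₁, h₂⟩ := applyTy_eq_some.mp hT
    obtain v₁ | ⟨_, s₁⟩ := ih₁ h₁
    swap
    · exact ⟨_, .appL _ s₁⟩
    obtain v₂ | ⟨_, s₂⟩ := ih₂ h₂
    swap
    · exact ⟨_, .appR v₁.isValue s₂⟩
    cases v₁ with
    | lam U _ => exact ⟨_, .beta _ _ v₂.isValue⟩
    | ca => simp [infer] at h₁
    | cf =>
      obtain ⟨rfl, rfl⟩ : MTy.base = S ∧ MTy.base = T := by simpa [infer] using h₁
      cases v₂ with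
      | lam => simp [infer] at h₂
      | ca => exact ⟨_, .fa⟩
      | cf => simp [infer] at h₂

end MTm

open Relation MTm

/-- Type Safety: the `→c`-normal forms of closed typable standard terms are
standard values. -/
theorem type_safety (t m : MTm) (T : MTy)
    (hstd : IsStandard t) (hclosed : ClosedUnder 0 t)
    (htyp : ReflTransGen StepA t (ofTy T))
    (hred : ReflTransGen StepC t m)
    (hnf : ∀ u, ¬ StepC m u) : IsStdValue m := by
  have hT : infer [] t = some T := by
    clear hred hstd hclosed
    induction htyp using ReflTransGen.head_induction_on with
    | refl => exact infer_ofTy [] T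
    | head h _ ih => exact h.infer_expansion ih
  obtain ⟨hm, hmT⟩ : IsStandard m ∧ infer [] m = some T := by
    clear hnf
    induction hred with
    | refl => exact ⟨hstd, hT⟩
    | tail _ h ih => exact ⟨h.isStandard ih.1, h.infer_preservation ih.2⟩
  exact (hm.progress hmT).resolve_right fun ⟨u, hu⟩ => hnf u hu
end

section
/- (Generalized Type Preservation for Call-By-Value Reduction) For all mixed terms m, m' and every type T: if m →ca* T and m →c m', then m' →ca* T, where →ca is the union of call-by-value reduction →c and abstract reduction →a. -/
open Relation MTm

namespace MTm

@[simp] theorem shift_ofTy (d c : ℕ) (T : MTy) : shift d c (ofTy T) = ofTy T := by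
  induction T generalizing c <;> simp_all [ofTy, shift]

@[simp] theorem subst_ofTy (j : ℕ) (s : MTm) (T : MTy) : subst j s (ofTy T) = ofTy T := by
  induction T generalizing j s <;> simp_all [ofTy, subst]

theorem shift_shift (m : MTm) {i c : ℕ} (h : i ≤ c) :
    shift 1 (c + 1) (shift 1 i m) = shift 1 i (shift 1 c m) := by
  induction m generalizing i c with
  | var k => simp only [shift]; split_ifs <;> simp only [shift] <;> split_ifs <;> grind
  | lam T m ih => simp [shift, ih (Nat.succ_le_succ h)]
  | app m n ihm ihn => simp [shift, ihm h, ihn h]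
  | arr T m ih => simp [shift, ih h]
  | _ => rfl

theorem subst_shift (s m : MTm) (i : ℕ) : subst i s (shift 1 i m) = m := by
  induction m generalizing i s with
  | var k => simp only [shift]; split_ifs <;> simp only [subst] <;> split_ifs <;> grind
  | lam T m ih => simp [shift, subst, ih]
  | app m n ihm ihn => simp [shift, subst, ihm, ihn]
  | arr T m ih => simp [shift, subst, ih]
  | _ => rfl

theorem shift_subst_ofTy (T : MTy) (m : MTm) {i c : ℕ} (h : i ≤ c) :
    shift 1 c (subst i (ofTy T) m) = subst i (ofTy T) (shift 1 (c + 1) m) := by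
  induction m generalizing i c with
  | var k =>
    simp only [shift, subst]
    split_ifs <;> simp only [shift, subst, shift_ofTy] <;> split_ifs <;> grind
  | lam T m ih => simp [shift, subst, ih (Nat.succ_le_succ h)]
  | app m n ihm ihn => simp [shift, subst, ihm h, ihn h]
  | arr T m ih => simp [shift, subst, ih h]
  | _ => rfl

theorem subst_subst_ofTy (T : MTy) (m s : MTm) {i j : ℕ} (h : i ≤ j) :
    subst j s (subst i (ofTy T) m) =
      subst i (ofTy T) (subst (j + 1) (shift 1 i s) m) := by
  induction m generalizing i j s with
  | var k =>
    simp only [subst]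
    split_ifs <;> simp only [subst, subst_ofTy, subst_shift] <;> (try split_ifs) <;> grind
  | lam T m ih =>
    simp [subst, ih _ (Nat.succ_le_succ h), shift_shift s (Nat.zero_le i)]
  | app m n ihm ihn => simp [subst, ihm _ h, ihn _ h]
  | arr T m ih => simp [subst, ih _ h]
  | _ => rfl

theorem StepA.shift {m n : MTm} (h : StepA m n) (c : ℕ) :
    StepA (shift 1 c m) (shift 1 c n) := by
  induction h generalizing c with
  | beta T m => simpa [MTm.shift] using StepA.beta T _
  | lamAbs T m =>
    simpa [MTm.shift, shift_subst_ofTy T m (Nat.zero_le c)] using StepA.lamAbs T _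
  | cfAbs => exact .cfAbs
  | caAbs => exact .caAbs
  | lamC T _ ih => exact .lamC T (ih _)
  | appL n _ ih => exact .appL _ (ih _)
  | appR n _ ih => exact .appR _ (ih _)
  | arrC T _ ih => exact .arrC T (ih _)

theorem StepA.subst {m n : MTm} (h : StepA m n) (j : ℕ) (s : MTm) :
    StepA (subst j s m) (subst j s n) := by
  induction h generalizing j s with
  | beta T m => simpa [MTm.subst] using StepA.beta T _
  | lamAbs T m =>
    simpa [MTm.subst, subst_subst_ofTy T m s (Nat.zero_le j)] using StepA.lamAbs T _
  | cfAbs => exact .cfAbs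
  | caAbs => exact .caAbs
  | lamC T _ ih => exact .lamC T (ih _ _)
  | appL n _ ih => exact .appL _ (ih _ _)
  | appR n _ ih => exact .appR _ (ih _ _)
  | arrC T _ ih => exact .arrC T (ih _ _)

theorem reflTransGen_stepA_app {m m' n n' : MTm} (hm : ReflTransGen StepA m m')
    (hn : ReflTransGen StepA n n') : ReflTransGen StepA (app m n) (app m' n') :=
  (hm.lift (app · n) fun _ _ h => .appL n h).trans (hn.lift (app m' ·) fun _ _ h => .appR m' h)

theorem reflTransGen_stepA_subst_right (m : MTm) {s s' : MTm} (h : ReflTransGen StepA s s')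
    (j : ℕ) : ReflTransGen StepA (subst j s m) (subst j s' m) := by
  induction m generalizing j s s' with
  | var k =>
    simp only [subst]
    split_ifs
    exacts [h, .refl, .refl]
  | lam T m ih =>
    exact (ih (h.lift (shift 1 0) fun _ _ h => h.shift 0) (j + 1)).lift _ fun _ _ => .lamC T
  | app m n ihm ihn => exact reflTransGen_stepA_app (ihm h j) (ihn h j)
  | arr T m ih => exact (ih h j).lift _ fun _ _ => .arrC T
  | _ => exact .refl

theorem isValue_ofTy (T : MTy) : IsValue (ofTy T) := by
  cases T
  exacts [.tyA, .arr _ _]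

theorem IsValue.not_stepC {u n : MTm} (h : IsValue u) : ¬ StepC u n := by
  intro hs
  cases h <;> cases hs

theorem IsValue.stepA {u n : MTm} (h : IsValue u) (hs : StepA u n) : IsValue n := by
  cases h <;> cases hs <;> constructor

theorem IsValue.reflTransGen_stepA {u n : MTm} (h : IsValue u)
    (hs : ReflTransGen StepA u n) : IsValue n := by
  induction hs with
  | refl => exact h
  | tail _ hs ih => exact ih.stepA hs

theorem StepA.app_inv {m n p : MTm} (h : StepA (app m n) p) :
    (∃ T, m = arr T p ∧ n = ofTy T) ∨ (∃ m', StepA m m' ∧ p = app m' n) ∨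
      ∃ n', StepA n n' ∧ p = app m n' := by
  cases h with
  | beta T => exact .inl ⟨T, rfl, rfl⟩
  | appL _ h => exact .inr (.inl ⟨_, h, rfl⟩)
  | appR _ h => exact .inr (.inr ⟨_, h, rfl⟩)

theorem StepC.deterministic {m n p : MTm} (hn : StepC m n) (hp : StepC m p) : n = p := by
  induction hn generalizing p with
  | beta T m hu =>
    cases hp with
    | beta => rfl
    | appL _ h => cases h
    | appR _ h => exact (hu.not_stepC h).elim
  | fa =>
    cases hp with
    | fa => rfl
    | appL _ h => cases h
    | appR _ h => cases h
  | appL _ h ih =>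
    cases hp with
    | beta => cases h
    | fa => cases h
    | appL _ h' => rw [ih h']
    | appR hu _ => exact (hu.not_stepC h).elim
  | appR hu h ih =>
    cases hp with
    | beta _ _ hu' => exact (hu'.not_stepC h).elim
    | fa => cases h
    | appL _ h' => exact (hu.not_stepC h').elim
    | appR _ h' => rw [ih h']

/-- `Blocked n p`: the term `n` is an evaluation context around an abstract application which
blocks call-by-value reduction, and once that application is contracted by abstract reduction,
its result is also an abstract reduct of `p`. -/
inductive Blocked : MTm → MTm → Prop
  | arr {T m u q} : IsValue u → (ReflTransGen StepA u (ofTy T) → ReflTransGen StepA q m) →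
      Blocked (app (arr T m) u) q
  | cf : Blocked (app cf tyA) ca
  | appL {n p r r'} : Blocked n p → ReflTransGen StepA r r' → Blocked (app n r') (app p r)
  | appR {n p u u'} : Blocked n p → IsValue u → ReflTransGen StepA u u' →
      Blocked (app u' n) (app u p)

theorem Blocked.not_isValue {n p : MTm} (h : Blocked n p) : ¬ IsValue n := by
  intro hv
  cases h <;> cases hv

theorem Blocked.not_stepC {n p q : MTm} (h : Blocked n p) : ¬ StepC n q := by
  induction h generalizing q with
  | arr hu _ =>
    intro hs
    cases hs with
    | appL _ h => cases h
    | appR _ h => exact hu.not_stepC h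
  | cf =>
    intro hs
    cases hs with
    | appL _ h => cases h
    | appR _ h => cases h
  | appL hb _ ih =>
    intro hs
    cases hs with
    | beta => cases hb
    | fa => cases hb
    | appL _ h => exact ih h
    | appR hu _ => exact hb.not_isValue hu
  | appR hb hu hr ih =>
    intro hs
    cases hs with
    | beta _ _ hv => exact hb.not_isValue hv
    | fa => cases hb
    | appL _ h => exact (hu.reflTransGen_stepA hr).not_stepC h
    | appR _ h => exact ih h

theorem Blocked.stepA {n n' p : MTm} (h : Blocked n p) (hs : StepA n n') :
    Blocked n' p ∨ ReflTransGen StepA p n' := by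
  induction h generalizing n' with
  | arr hu hq =>
    rcases hs.app_inv with ⟨T, hT, rfl⟩ | ⟨m', hm, rfl⟩ | ⟨u', hu', rfl⟩
    · cases hT
      exact .inr (hq .refl)
    · cases hm with
      | arrC _ hm => exact .inl (.arr hu fun h => (hq h).tail hm)
    · exact .inl (.arr (hu.stepA hu') fun h => hq (h.head hu'))
  | cf =>
    rcases hs.app_inv with ⟨T, hT, _⟩ | ⟨m', hm, rfl⟩ | ⟨u', hu', rfl⟩
    · cases hT
    · cases hm
      exact .inl (.arr .tyA fun _ => .single .caAbs)
    · cases hu'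
  | appL hb hr ih =>
    rcases hs.app_inv with ⟨T, rfl, rfl⟩ | ⟨m', hm, rfl⟩ | ⟨u', hu', rfl⟩
    · cases hb
    · rcases ih hm with h | h
      · exact .inl (.appL h hr)
      · exact .inr (reflTransGen_stepA_app h hr)
    · exact .inl (.appL hb (hr.tail hu'))
  | appR hb hu hr ih =>
    rcases hs.app_inv with ⟨T, rfl, rfl⟩ | ⟨m', hm, rfl⟩ | ⟨u', hu', rfl⟩
    · exact (hb.not_isValue (isValue_ofTy T)).elim
    · exact .inl (.appR hb hu (hr.tail hm))
    · rcases ih hu' with h | h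
      · exact .inl (.appR h hu hr)
      · exact .inr (reflTransGen_stepA_app hr h)

theorem Blocked.reaches_ofTy {n p : MTm} {T : MTy} (h : Blocked n p)
    (hn : ReflTransGen (fun x y => StepC x y ∨ StepA x y) n (ofTy T)) :
    ReflTransGen (fun x y => StepC x y ∨ StepA x y) p (ofTy T) := by
  induction hn using ReflTransGen.head_induction_on with
  | refl => exact (h.not_isValue (isValue_ofTy T)).elim
  | head hs hrest ih =>
    rcases hs with hs | hs
    · exact (h.not_stepC hs).elim
    · rcases h.stepA hs with h' | h'
      · exact ih h'
      · exact (ReflTransGen.mono (fun _ _ => .inr) _ _ h').trans hrest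

/-- A call-by-value step and an abstract step either commute, or the abstract step blocks
the call-by-value redex. -/
theorem StepC.stepA_blocked_or_join {m m' n : MTm} (hc : StepC m m') (ha : StepA m n) :
    Blocked n m' ∨ ∃ q, StepC n q ∧ ReflTransGen StepA m' q := by
  induction hc generalizing n with
  | beta T m hu =>
    rcases ha.app_inv with ⟨T, hT, _⟩ | ⟨m', hm, rfl⟩ | ⟨u', hu', rfl⟩
    · cases hT
    · cases hm with
      | lamAbs => exact .inl (.arr hu fun h => reflTransGen_stepA_subst_right m h 0)
      | lamC _ hm => exact .inr ⟨_, .beta T _ hu, .single (hm.subst 0 _)⟩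
    · exact .inr ⟨_, .beta T m (hu.stepA hu'), reflTransGen_stepA_subst_right m (.single hu') 0⟩
  | fa =>
    rcases ha.app_inv with ⟨T, hT, _⟩ | ⟨m', hm, rfl⟩ | ⟨u', hu', rfl⟩
    · cases hT
    · cases hm
      exact .inl (.arr .ca id)
    · cases hu'
      exact .inl .cf
  | appL r h ih =>
    rcases ha.app_inv with ⟨T, rfl, rfl⟩ | ⟨m', hm, rfl⟩ | ⟨r', hr, rfl⟩
    · cases h
    · rcases ih hm with hb | ⟨q, hq, hs⟩
      · exact .inl (.appL hb .refl)
      · exact .inr ⟨_, .appL r hq, reflTransGen_stepA_app hs .refl⟩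
    · exact .inr ⟨_, .appL r' h, .single (.appR _ hr)⟩
  | appR hu h ih =>
    rcases ha.app_inv with ⟨T, rfl, rfl⟩ | ⟨u', hu', rfl⟩ | ⟨r', hr, rfl⟩
    · exact ((isValue_ofTy T).not_stepC h).elim
    · exact .inr ⟨_, .appR (hu.stepA hu') h, .single (.appL _ hu')⟩
    · rcases ih hr with hb | ⟨q, hq, hs⟩
      · exact .inl (.appR hb hu .refl)
      · exact .inr ⟨_, .appR hu hq, reflTransGen_stepA_app .refl hs⟩

end MTm

/-- Generalized Type Preservation for call-by-value reduction:
generalized typability (`→ca`-reduction to a type) is preserved by `→c`. -/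
theorem generalized_type_preservation (m m' : MTm) (T : MTy)
    (h1 : ReflTransGen (fun x y => StepC x y ∨ StepA x y) m (ofTy T))
    (h2 : StepC m m') :
    ReflTransGen (fun x y => StepC x y ∨ StepA x y) m' (ofTy T) := by
  induction h1 using ReflTransGen.head_induction_on generalizing m' with
  | refl => exact ((isValue_ofTy T).not_stepC h2).elim
  | head hs hrest ih =>
    rcases hs with hs | hs
    · rwa [h2.deterministic hs]
    · rcases h2.stepA_blocked_or_join hs with hb | ⟨q, hq, hm'⟩
      · exact hb.reaches_ofTy hrest
      · exact (ReflTransGen.mono (fun _ _ => .inr) _ _ hm').trans (ih q hq)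
end
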